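/- arXiv:0902.0140 — 3 statements merged into one kernel-verified Lean document; each statement's English description precedes it below -/
import Mathlib

section
/- In the setting of the single-cut sampling process with edges e_{i_1},…,e_{i_l} of a cut listed in arrival order, fix p ∈ (0,1], suppose w_G(e_{i_j}) ≤ 1 for all j, set μ_j = p·w_G(e_{i_j}), and let Y_j be as in the two-case definition (Y_j = p·w_H(e_{i_j}) if p_{e_{i_j}} ≥ p, and Y_j = μ_j otherwise). Let S_j = Σ_{k=j}^{l} Y_k. Then for every real t, every index j, and every possible state H_{i_j−1} of the sparsification just before e_{i_j} is processed, E[exp(t·S_j) | H_{i_j−1}] ≤ exp(Σ_{k=j}^{l} μ_k·(e^t − 1)). -/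
open MeasureTheory

variable {V : Type*}

/-- The product of `m` independent uniform distributions on `[0,1]`: the randomness of the
streaming process (coordinate `i` is the seed deciding the fate of the `i`-th edge). -/
noncomputable def streamMeasure (m : ℕ) : Measure (Fin m → ℝ) :=
  Measure.pi fun _ => volume.restrict (Set.Icc (0 : ℝ) 1)

/-- The sampling decisions of a general streaming sampling process: edge `i` is kept iff
the uniform-[0,1] seed `ω i` is at most `p i h`, where `h` records the decisions made on
the earlier edges (`p` is required to depend only on those in the theorems below). -/
noncomputable def decs {m : ℕ} (p : Fin m → (Fin m → Bool) → ℝ) (ω : Fin m → ℝ) :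
    ℕ → Fin m → Bool
  | 0 => fun _ => false
  | k + 1 => fun i =>
      if i.val = k then (if ω i ≤ p i (decs p ω k) then true else false) else decs p ω k i

/-- The (indices of) stream edges of positive weight crossing the vertex cut `(S, Sᶜ)`,
i.e. the edges of the cut determined by `S`. -/
noncomputable def cutEdges [Fintype V] [DecidableEq V] {m : ℕ} (edges : Fin m → V × V)
    (wG : Fin m → ℝ) (S : Finset V) : Finset (Fin m) :=
  Finset.univ.filter fun i => 0 < wG i ∧
    (((edges i).1 ∈ S ∧ (edges i).2 ∉ S) ∨ ((edges i).1 ∉ S ∧ (edges i).2 ∈ S))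

/-- Combination of a fixed prefix of random seeds (coordinates before `i₀`, describing the
state `H_{i₀−1}` of the sparsification) with fresh seeds for the remaining coordinates. -/
def mix {m : ℕ} (i₀ : Fin m) (ωpre ω : Fin m → ℝ) : Fin m → ℝ :=
  fun k => if k.val < i₀.val then ωpre k else ω k

open Finset in
/-- Integrating out one coordinate: if `F` does not depend on the coordinate `i` and the average of
`Z` over that coordinate is at most `c`, then the factor `Z` costs at most `c`. -/
theorem lintegral_pi_mul_le {ι : Type*} [Fintype ι] [DecidableEq ι] (μ : ι → Measure ℝ)
    [∀ i, IsProbabilityMeasure (μ i)] {F Z : (ι → ℝ) → ENNReal} (hF : Measurable F)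
    (hZ : Measurable Z) (i : ι) (hFi : ∀ x y, F (Function.update x i y) = F x) (c : ENNReal)
    (hc : ∀ x, ∫⁻ y, Z (Function.update x i y) ∂(μ i) ≤ c) :
    ∫⁻ x, F x * Z x ∂(Measure.pi μ) ≤ (∫⁻ x, F x ∂(Measure.pi μ)) * c := by
  rcases isEmpty_or_nonempty (ι → ℝ) with h | ⟨⟨x₀⟩⟩
  · simp
  rw [← lintegral_mul_const _ hF, lintegral_eq_lmarginal_univ x₀, lintegral_eq_lmarginal_univ x₀,
    lmarginal_erase' _ (hF.fun_mul hZ) (mem_univ i),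
    lmarginal_erase' _ (hF.mul_const c) (mem_univ i)]
  refine lmarginal_mono (fun x => ?_) x₀
  simp only [hFi, lintegral_const, measure_univ, mul_one]
  rw [lintegral_const_mul _ (by fun_prop)]
  gcongr
  exact hc x

/-- An adapted product of nonnegative factors, each with conditional mean at most `c i`, has mean
at most `∏ c i`. -/
theorem lintegral_pi_prod_le {m : ℕ} (μ : Fin m → Measure ℝ) [∀ i, IsProbabilityMeasure (μ i)]
    {Z : Fin m → (Fin m → ℝ) → ENNReal} (hZ : ∀ i, Measurable (Z i)) (c : Fin m → ENNReal)
    (A : Finset (Fin m))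
    (hadapt : ∀ i ∈ A, ∀ j ∈ A, i < j → ∀ x y, Z i (Function.update x j y) = Z i x)
    (hc : ∀ i ∈ A, ∀ x, ∫⁻ y, Z i (Function.update x i y) ∂(μ i) ≤ c i) :
    ∫⁻ x, ∏ i ∈ A, Z i x ∂(Measure.pi μ) ≤ ∏ i ∈ A, c i := by
  induction A using Finset.induction_on_max with
  | empty => simp
  | insert a s hs ih =>
    have ha : a ∉ s := fun h => (hs a h).false
    simp only [Finset.prod_insert ha, mul_comm (Z a _), mul_comm (c a)]
    refine (lintegral_pi_mul_le μ (Finset.measurable_fun_prod s fun i _ => hZ i) (hZ a) a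
      (fun x y => ?_) (c a) (hc a (by simp))).trans ?_
    · exact Finset.prod_congr rfl fun i hi =>
        hadapt i (by simp [hi]) a (by simp) (hs i hi) x y
    · gcongr
      exact ih (fun i hi j hj => hadapt i (by simp [hi]) j (by simp [hj]))
        (fun i hi => hc i (by simp [hi]))

theorem decs_eq_of_lt {m : ℕ} (p : Fin m → (Fin m → Bool) → ℝ) (ω : Fin m → ℝ) {k : ℕ}
    (i : Fin m) (hi : i.val < k) : decs p ω k i = decide (ω i ≤ p i (decs p ω i)) := by
  induction k with
  | zero => omega
  | succ k ih =>
    rcases eq_or_ne i.val k with h | h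
    · subst h
      simp [decs]
    · simpa [decs, h] using ih (by omega)

theorem decs_congr {m : ℕ} (p : Fin m → (Fin m → Bool) → ℝ) {ω ω' : Fin m → ℝ} {k : ℕ}
    (h : ∀ i : Fin m, i.val < k → ω i = ω' i) : decs p ω k = decs p ω' k := by
  induction k with
  | zero => rfl
  | succ k ih =>
    funext i
    have hk := ih fun i hi => h i (by omega)
    rcases eq_or_ne i.val k with hi | hi
    · simp [decs, hi, hk, h i (by omega)]
    · simp [decs, hi, hk]

theorem measurable_decs {m : ℕ} (p : Fin m → (Fin m → Bool) → ℝ) (k : ℕ) :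
    Measurable fun ω : Fin m → ℝ => decs p ω k := by
  induction k with
  | zero => exact measurable_const
  | succ k ih =>
    refine measurable_pi_lambda _ fun i => ?_
    rcases eq_or_ne i.val k with hi | hi
    · simp only [decs, hi, if_true]
      exact Measurable.ite
        (measurableSet_le (measurable_pi_apply i) ((measurable_of_countable (p i)).comp ih))
        measurable_const measurable_const
    · simp only [decs, hi, if_false]
      exact (measurable_pi_apply i).comp ih

theorem measurable_mix {m : ℕ} (i₀ : Fin m) (ωpre : Fin m → ℝ) : Measurable (mix i₀ ωpre) := by
  refine measurable_pi_lambda _ fun k => ?_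
  unfold mix
  split_ifs <;> fun_prop

theorem lintegral_unitInterval_ite {P : ℝ} (hP0 : 0 < P) (hP1 : P ≤ 1) (a b : ENNReal) :
    ∫⁻ y, (if y ≤ P then a else b) ∂(volume.restrict (Set.Icc (0 : ℝ) 1)) =
      ENNReal.ofReal P * a + ENNReal.ofReal (1 - P) * b := by
  have h1 : Set.Iic P ∩ Set.Icc (0 : ℝ) 1 = Set.Icc 0 P := by
    ext y; simp only [Set.mem_inter_iff, Set.mem_Iic, Set.mem_Icc]; grind
  have h2 : (Set.Iic P)ᶜ ∩ Set.Icc (0 : ℝ) 1 = Set.Ioc P 1 := by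
    ext y; simp only [Set.mem_inter_iff, Set.mem_compl_iff, Set.mem_Iic, Set.mem_Icc, Set.mem_Ioc]
    grind
  have hm : MeasurableSet (Set.Iic P) := measurableSet_Iic
  rw [← lintegral_add_compl _ hm,
    setLIntegral_congr_fun (f := fun y => if y ≤ P then a else b) (g := fun _ => a) hm
      (fun y hy => if_pos hy),
    setLIntegral_congr_fun (f := fun y => if y ≤ P then a else b) (g := fun _ => b) hm.compl
      (fun y hy => if_neg hy)]
  simp [h1, h2, mul_comm,
    -Set.compl_Iic]

/-- The moment generating function of a rescaled Bernoulli variable with values in `{0, w / P}`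
is at most that of a Poisson variable with the same mean. -/
theorem bernoulli_mgf_le {P q w : ℝ} (hq0 : 0 < q) (hqP : q ≤ P) (hw : 0 ≤ w) (hw1 : w ≤ 1)
    (t : ℝ) :
    P * Real.exp (t * (q * (w / P))) + (1 - P) ≤ Real.exp (q * w * (Real.exp t - 1)) := by
  have hP : 0 < P := hq0.trans_le hqP
  set x := q * (w / P) with hx
  have hx0 : 0 ≤ x := by positivity
  have hPx : P * x = q * w := by rw [hx]; field_simp
  have hx1 : x ≤ 1 := by
    refine le_of_mul_le_mul_left ?_ hP
    nlinarith
  have hconv : Real.exp (t * x) ≤ x * Real.exp t + (1 - x) := by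
    have := convexOn_exp.2 (Set.mem_univ t) (Set.mem_univ 0) hx0 (sub_nonneg.2 hx1) (by ring)
    simpa [mul_comm] using this
  calc P * Real.exp (t * x) + (1 - P) ≤ P * (x * Real.exp t + (1 - x)) + (1 - P) := by gcongr
    _ = q * w * (Real.exp t - 1) + 1 := by rw [← hPx]; ring
    _ ≤ _ := Real.add_one_le_exp _

/-- The summand `Y_i` of the suffix sum, as a function of the sampling probability `P` and the
decision `b`. -/
noncomputable def cutIncrement (q w P : ℝ) (b : Prop) [Decidable b] : ℝ :=
  if q ≤ P then q * (if b then w / P else 0) else q * w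

theorem lintegral_cutIncrement_le {P q w : ℝ} (hq0 : 0 < q) (hP0 : 0 < P) (hP1 : P ≤ 1)
    (hw : 0 ≤ w) (hw1 : w ≤ 1) (t : ℝ) :
    ∫⁻ y, ENNReal.ofReal (Real.exp (t * cutIncrement q w P (y ≤ P)))
        ∂(volume.restrict (Set.Icc (0 : ℝ) 1)) ≤
      ENNReal.ofReal (Real.exp (q * w * (Real.exp t - 1))) := by
  unfold cutIncrement
  split_ifs with hqP
  · have h (y : ℝ) : ENNReal.ofReal (Real.exp (t * (q * (if y ≤ P then w / P else 0)))) =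
        if y ≤ P then ENNReal.ofReal (Real.exp (t * (q * (w / P)))) else 1 := by
      split_ifs <;> simp
    simp only [h]
    rw [lintegral_unitInterval_ite hP0 hP1, mul_one, ← ENNReal.ofReal_mul hP0.le,
      ← ENNReal.ofReal_add (by positivity) (by linarith)]
    exact ENNReal.ofReal_le_ofReal (bernoulli_mgf_le hq0 hqP hw hw1 t)
  · simp only [lintegral_const, Measure.restrict_apply_univ, Real.volume_Icc, sub_zero,
      ENNReal.ofReal_one, mul_one]
    refine ENNReal.ofReal_le_ofReal (Real.exp_le_exp.2 ?_)
    rw [mul_comm t]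
    have := Real.add_one_le_exp t
    gcongr
    linarith

/-- **martingale mgf bound for a suffix of a cut.**  In the single-cut
sampling process, with the cut edges `C = {e_{i_1} < ⋯ < e_{i_l}}` of weight at most `1`,
`μ_k = q·w_G(e_{i_k})`, and `Y_k` defined by the two cases (`Y_k = q·w_H(e_{i_k})` if
`p_{e_{i_k}} ≥ q`, `Y_k = μ_k` otherwise), let `S_j = Σ_{k=j}^{l} Y_k` — here realized as
the sum over the cut edges `i ≥ i₀` where `i₀ = e_{i_j}` is a cut edge.  Then for every
real `t` and every possible state `H_{i_j−1}` (i.e. every fixed prefix `ωpre` of seeds),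
`E[exp(t·S_j) | H_{i_j−1}] ≤ exp(Σ_{k=j}^{l} μ_k·(e^t − 1))`. -/
theorem suffix_mgf_bound (V : Type) [Fintype V] [DecidableEq V] (m : ℕ)
    (edges : Fin m → V × V) (wG : Fin m → ℝ) (hw : ∀ i, 0 ≤ wG i)
    (S : Finset V) (hS : S.Nonempty) (hS' : Sᶜ.Nonempty)
    (hw1 : ∀ i ∈ cutEdges edges wG S, wG i ≤ 1)
    (p : Fin m → (Fin m → Bool) → ℝ)
    (hp : ∀ i b, 0 < p i b ∧ p i b ≤ 1)
    (hhist : ∀ (i : Fin m) (b b' : Fin m → Bool),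
      (∀ j : Fin m, j < i → b j = b' j) → p i b = p i b')
    (q : ℝ) (hq0 : 0 < q) (hq1 : q ≤ 1)
    (t : ℝ) (i₀ : Fin m) (hi₀ : i₀ ∈ cutEdges edges wG S) (ωpre : Fin m → ℝ) :
    (∫ ω, Real.exp (t * ∑ i ∈ (cutEdges edges wG S).filter (fun i => i₀ ≤ i),
          (if q ≤ p i (decs p (mix i₀ ωpre ω) m) then
            q * (if decs p (mix i₀ ωpre ω) m i then
                  wG i / p i (decs p (mix i₀ ωpre ω) m) else 0)
          else q * wG i)) ∂(streamMeasure m)) ≤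
      Real.exp (∑ i ∈ (cutEdges edges wG S).filter (fun i => i₀ ≤ i),
        (q * wG i) * (Real.exp t - 1)) := by
  have : IsProbabilityMeasure (volume.restrict (Set.Icc (0 : ℝ) 1)) := ⟨by simp⟩
  set A := (cutEdges edges wG S).filter fun i => i₀ ≤ i
  have hA : ∀ i ∈ A, i₀ ≤ i ∧ wG i ≤ 1 := fun i hi =>
    ⟨(Finset.mem_filter.1 hi).2, hw1 i (Finset.mem_filter.1 hi).1⟩
  let P (i : Fin m) (ω : Fin m → ℝ) : ℝ := p i (decs p (mix i₀ ωpre ω) i)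
  let Y (i : Fin m) (ω : Fin m → ℝ) : ℝ :=
    cutIncrement q (wG i) (P i ω) (mix i₀ ωpre ω i ≤ P i ω)
  have hY : ∀ i ω, (if q ≤ p i (decs p (mix i₀ ωpre ω) m) then
      q * (if decs p (mix i₀ ωpre ω) m i then
        wG i / p i (decs p (mix i₀ ωpre ω) m) else 0)
      else q * wG i) = Y i ω := by
    intro i ω
    have hPi : p i (decs p (mix i₀ ωpre ω) m) = P i ω := hhist i _ _ fun j hj => by
      rw [decs_eq_of_lt _ _ j j.isLt, decs_eq_of_lt _ _ j hj]
    simp only [hPi, decs_eq_of_lt p _ i i.isLt, decide_eq_true_eq]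
    rfl
  have hPmeas (i : Fin m) : Measurable (P i) :=
    (measurable_of_countable (p i)).comp ((measurable_decs p i).comp (measurable_mix i₀ ωpre))
  have hmix (i : Fin m) : Measurable fun ω => mix i₀ ωpre ω i :=
    (measurable_pi_apply i).comp (measurable_mix i₀ ωpre)
  have hYmeas (i : Fin m) : Measurable (Y i) :=
    Measurable.ite (measurableSet_le measurable_const (hPmeas i))
      ((Measurable.ite (measurableSet_le (hmix i) (hPmeas i))
        (measurable_const.div (hPmeas i)) measurable_const).const_mul q) measurable_const
  have hmix_update {i j : Fin m} (hij : i ≠ j) (x : Fin m → ℝ) (y : ℝ) :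
      mix i₀ ωpre (Function.update x j y) i = mix i₀ ωpre x i := by
    simp [mix, Function.update_of_ne hij]
  have hP_update {i j : Fin m} (hij : i ≤ j) (x : Fin m → ℝ) (y : ℝ) :
      P i (Function.update x j y) = P i x := by
    simp only [P]
    rw [decs_congr p fun k hk => hmix_update (ne_of_lt (lt_of_lt_of_le hk hij)) x y]
  have hY_update {i j : Fin m} (hij : i < j) (x : Fin m → ℝ) (y : ℝ) :
      Y i (Function.update x j y) = Y i x := by
    simp only [Y, hP_update hij.le, hmix_update hij.ne]
  simp only [hY]
  rw [integral_eq_lintegral_of_nonneg_ae (ae_of_all _ fun ω => (Real.exp_pos _).le)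
    (by fun_prop)]
  refine ENNReal.toReal_le_of_le_ofReal (Real.exp_pos _).le ?_
  simp only [Finset.mul_sum, Real.exp_sum]
  rw [ENNReal.ofReal_prod_of_nonneg fun i _ => (Real.exp_pos _).le]
  simp only [ENNReal.ofReal_prod_of_nonneg fun i _ => (Real.exp_pos _).le]
  refine lintegral_pi_prod_le (fun _ => volume.restrict (Set.Icc (0 : ℝ) 1))
    (Z := fun i ω => ENNReal.ofReal (Real.exp (t * Y i ω))) (fun i => by fun_prop) _ A
    (fun i _ j _ hij x y => by simp only [hY_update hij]) fun i hi x => ?_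
  have hmix_self (y : ℝ) : mix i₀ ωpre (Function.update x i y) i = y := by
    simp [mix, Fin.lt_def.symm, (hA i hi).1]
  simp only [Y, hP_update le_rfl, hmix_self]
  exact lintegral_cutIncrement_le hq0 (hp i _).1 (hp i _).2 (hw i) (hA i hi).2 t
end

section
/- Fix 0 < ε < 1, let r = (1+ε)/(1−ε), and let C ≥ 1. Let F be the family of weighted stars on n vertices with a common center u in which each of the other n−1 vertices is joined to u by an edge whose weight lies in {1, R, R², …} ∩ [1, C], where R > r is a fixed ratio; thus |F| = (1+⌊log_R C⌋)^{n−1}. Then no weighted graph H can satisfy H ∈ (1±ε)G and H ∈ (1±ε)G′ for two distinct G, G′ ∈ F; consequently, any scheme that encodes each G ∈ F into a bit string from which some weighted graph H with H ∈ (1±ε)G can be recovered must use at least log₂|F| = (n−1)·log₂(1+⌊log_R C⌋) bits, which is Ω(n·log(1/ε)) bits for R = r², i.e. Ω(n·(log C + log(1/ε)))-type lower bounds on the space needed to sparsify weighted graphs follow from counting F. -/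
open MeasureTheory

variable {V : Type*}

/-- Value of the cut `(S, Sᶜ)` in the weighted graph with weight function `w`:
each unordered crossing pair is counted once, with one endpoint in `S` and one in `Sᶜ`. -/
def cutVal [Fintype V] [DecidableEq V] (w : V → V → ℝ) (S : Finset V) : ℝ :=
  ∑ u ∈ S, ∑ v ∈ Sᶜ, w u v

/-- `H ∈ (1 ± ε) G` : every cut value of `H` is within a `(1 ± ε)` factor of the
corresponding cut value of `G`. -/
def IsSparsifier [Fintype V] [DecidableEq V] (ε : ℝ) (H G : V → V → ℝ) : Prop :=
  ∀ S : Finset V, S.Nonempty → Sᶜ.Nonempty →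
    (1 - ε) * cutVal G S ≤ cutVal H S ∧ cutVal H S ≤ (1 + ε) * cutVal G S

/-- The weighted star on the vertex set `Option (Fin N)` (center `none`, `N` leaves) in
which leaf `i` is joined to the center by an edge of weight `R ^ (a i)`. -/
def starW (R : ℝ) {N K : ℕ} (a : Fin N → Fin (K + 1)) :
    Option (Fin N) → Option (Fin N) → ℝ
  | none, some i => R ^ (a i : ℕ)
  | some i, none => R ^ (a i : ℕ)
  | _, _ => 0

theorem cutVal_starW_singleton (R : ℝ) {N K : ℕ} (a : Fin N → Fin (K + 1)) (i : Fin N) :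
    cutVal (starW R a) {some i} = R ^ (a i : ℕ) := by
  rw [cutVal, Finset.sum_singleton, Finset.sum_eq_single none]
  · rfl
  · rintro (_ | j) _ hj
    · exact absurd rfl hj
    · rfl
  · intro h
    simp at h

/-- A common sparsifier of two stars forces each exponent of one to be at most the
corresponding exponent of the other. -/
theorem IsSparsifier.exponent_le {ε R : ℝ} (hε0 : 0 < ε) (hε1 : ε < 1)
    (hR : (1 + ε) / (1 - ε) < R) {N K : ℕ} {a a' : Fin N → Fin (K + 1)}
    {H : Option (Fin N) → Option (Fin N) → ℝ}
    (h : IsSparsifier ε H (starW R a)) (h' : IsSparsifier ε H (starW R a')) (i : Fin N) :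
    a' i ≤ a i := by
  by_contra! hlt
  have hpos : 0 < 1 - ε := by linarith
  have hR' : 1 + ε < (1 - ε) * R := by
    rw [mul_comm]
    exact (div_lt_iff₀ hpos).1 hR
  have hR1 : 1 < R := by nlinarith
  have hcompl : ({some i} : Finset (Option (Fin N)))ᶜ.Nonempty := ⟨none, by simp⟩
  have hup := (h _ (Finset.singleton_nonempty _) hcompl).2
  have hlow := (h' _ (Finset.singleton_nonempty _) hcompl).1
  rw [cutVal_starW_singleton] at hup hlow
  have hpow : R ^ ((a i : ℕ) + 1) ≤ R ^ (a' i : ℕ) := pow_le_pow_right₀ hR1.le hlt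
  have hbase : 0 < R ^ (a i : ℕ) := by positivity
  rw [pow_succ] at hpow
  have := mul_le_mul_of_nonneg_left hpow hpos.le
  have := mul_lt_mul_of_pos_right hR' hbase
  linarith

theorem IsSparsifier.starW_injective {ε R : ℝ} (hε0 : 0 < ε) (hε1 : ε < 1)
    (hR : (1 + ε) / (1 - ε) < R) {N K : ℕ} {a a' : Fin N → Fin (K + 1)}
    {H : Option (Fin N) → Option (Fin N) → ℝ}
    (h : IsSparsifier ε H (starW R a)) (h' : IsSparsifier ε H (starW R a')) : a = a' :=
  funext fun i => le_antisymm (h'.exponent_le hε0 hε1 hR h i) (h.exponent_le hε0 hε1 hR h' i)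

/-- **lower bound, weighted graphs.**  Fix `0 < ε < 1`, `r = (1+ε)/(1−ε)`,
`C ≥ 1` and a ratio `R > r`.  Let `F` be the family of weighted stars on `n = N + 1`
vertices with common center in which each of the `N` leaves is joined to the center by an
edge of weight in `{1, R, R², …} ∩ [1, C]`; with `K = ⌊log_R C⌋` the family is indexed by
`a : Fin N → Fin (K+1)` and `|F| = (K+1)^N`.  Then (i) no weighted graph `H` can be an
`ε`-sparsifier of two distinct members of `F`, and (ii) any scheme encoding each `G ∈ F`
into an `L`-bit string from which some `H` with `H ∈ (1±ε)G` can be recovered must have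
`L ≥ log₂|F| = N·log₂(K+1)` — the `Ω(n(log C + log(1/ε)))`-type space lower bound. -/
theorem weighted_lower_bound (ε : ℝ) (hε0 : 0 < ε) (hε1 : ε < 1)
    (C R : ℝ) (hC : 1 ≤ C) (hR : (1 + ε) / (1 - ε) < R)
    (N : ℕ) (hN : 1 ≤ N) (K : ℕ) (hK : K = Nat.floor (Real.logb R C)) :
    (∀ a a' : Fin N → Fin (K + 1),
      ∀ H : Option (Fin N) → Option (Fin N) → ℝ,
        (∀ u v, H u v = H v u) → (∀ u v, 0 ≤ H u v) →
        IsSparsifier ε H (starW R a) → IsSparsifier ε H (starW R a') → a = a') ∧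
    (∀ (L : ℕ) (enc : (Fin N → Fin (K + 1)) → Fin L → Bool)
        (dec : (Fin L → Bool) → Option (Fin N) → Option (Fin N) → ℝ),
      (∀ a, IsSparsifier ε (dec (enc a)) (starW R a)) →
      (N : ℝ) * Real.logb 2 ((K : ℝ) + 1) ≤ L) := by
  refine ⟨fun a a' H _ _ h h' => h.starW_injective hε0 hε1 hR h', fun L enc dec hdec => ?_⟩
  have hinj : Function.Injective enc := fun a a' haa' =>
    (hdec a).starW_injective hε0 hε1 hR (haa' ▸ hdec a')
  have hcard : (K + 1) ^ N ≤ 2 ^ L := by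
    simpa using Fintype.card_le_of_injective enc hinj
  have hcard' : ((K : ℝ) + 1) ^ N ≤ 2 ^ L := by exact_mod_cast hcard
  rw [← Real.logb_pow, Real.logb_le_iff_le_rpow one_lt_two (by positivity), Real.rpow_natCast]
  exact hcard'
end

section
/- Fix 0 < ε < 1 and r = (1+ε)/(1−ε). Let d_0 < d_1 < ⋯ < d_K ≤ n/2 be positive integers with d_{i+1} > r·d_i for all i (one may take K+1 = Θ(log_r n)). Let F be a family of bipartite unweighted graphs with n/2 vertices on each side, one graph for each assignment of a degree from {d_0,…,d_K} to each left vertex (such graphs exist for every assignment), with distinct assignments giving distinct members of F. Then no weighted graph H can satisfy H ∈ (1±ε)G and H ∈ (1±ε)G′ for two distinct G, G′ ∈ F; consequently any scheme that encodes each G ∈ F into a bit string from which some weighted graph H with H ∈ (1±ε)G can be recovered must use at least log₂|F| = (n/2)·log₂(K+1) bits, which is Ω(n·(log log n + log(1/ε))). -/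
open MeasureTheory

variable {V : Type*}

/-- The bipartite unweighted graph on `Fin M ⊕ Fin M` (left and right sides of size `M`)
realizing a degree assignment: left vertex `j` is joined to the first `d (a j)` right
vertices, so its degree is `d (a j)`. -/
def bipW {M K : ℕ} (d : Fin (K + 1) → ℕ) (a : Fin M → Fin (K + 1)) :
    (Fin M ⊕ Fin M) → (Fin M ⊕ Fin M) → ℝ
  | Sum.inl j, Sum.inr t => if (t : ℕ) < d (a j) then 1 else 0
  | Sum.inr t, Sum.inl j => if (t : ℕ) < d (a j) then 1 else 0
  | _, _ => 0

/-- The cut isolating a left vertex has value the degree of that vertex. -/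
theorem cutVal_bipW_singleton_inl {M K : ℕ} (d : Fin (K + 1) → ℕ) (a : Fin M → Fin (K + 1))
    (j : Fin M) (hd : d (a j) ≤ M) :
    cutVal (bipW d a) {Sum.inl j} = d (a j) := by
  have hself : bipW d a (Sum.inl j) (Sum.inl j) = 0 := rfl
  have hsum : ∑ v ∈ ({Sum.inl j} : Finset (Fin M ⊕ Fin M))ᶜ, bipW d a (Sum.inl j) v
      = ∑ v, bipW d a (Sum.inl j) v := by
    rw [← Finset.sum_add_sum_compl {Sum.inl j}, Finset.sum_singleton, hself, zero_add]
  rw [cutVal, Finset.sum_singleton, hsum, Fintype.sum_sum_type]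
  simp only [bipW, Finset.sum_const_zero, zero_add]
  rw [Finset.sum_boole, Fin.card_filter_val_lt, min_eq_right hd]

/-- A positive sequence whose consecutive terms grow by a factor exceeding `r ≥ 1`
has this property for all pairs of indices. -/
theorem mul_lt_of_ratio_lt {K : ℕ} {r : ℝ} (hr : 1 ≤ r) (d : Fin (K + 1) → ℕ)
    (hratio : ∀ i : Fin K, r * d i.castSucc < d i.succ) {i k : Fin (K + 1)} (hik : i < k) :
    r * d i < d k := by
  have hmono : StrictMono d := Fin.strictMono_iff_lt_succ.2 fun i => by
    have h : (d i.castSucc : ℝ) < d i.succ :=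
      (le_mul_of_one_le_left (Nat.cast_nonneg _) hr).trans_lt (hratio i)
    exact_mod_cast h
  obtain ⟨m, rfl⟩ := Fin.exists_castSucc_eq.2 (Fin.ne_last_of_lt hik)
  have hle : d m.succ ≤ d k := hmono.monotone (Fin.castSucc_lt_iff_succ_le.1 hik)
  exact (hratio m).trans_le (by exact_mod_cast hle)

/-- Two members of the family with a common sparsifier have the same degree assignment. -/
theorem eq_of_isSparsifier_bipW {ε : ℝ} (hε0 : 0 < ε) (hε1 : ε < 1) {M K : ℕ}
    {d : Fin (K + 1) → ℕ}
    (hdratio : ∀ i : Fin K, ((1 + ε) / (1 - ε)) * d i.castSucc < d i.succ)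
    (hdle : ∀ i, d i ≤ M) {a a' : Fin M → Fin (K + 1)}
    {H : (Fin M ⊕ Fin M) → (Fin M ⊕ Fin M) → ℝ}
    (h : IsSparsifier ε H (bipW d a)) (h' : IsSparsifier ε H (bipW d a')) : a = a' := by
  have hpos : 0 < 1 - ε := sub_pos.2 hε1
  have hr : 1 ≤ (1 + ε) / (1 - ε) := (one_le_div hpos).2 (by linarith)
  have hnot : ∀ {b b' : Fin M → Fin (K + 1)}, IsSparsifier ε H (bipW d b) →
      IsSparsifier ε H (bipW d b') → ∀ j, ¬ b j < b' j := by
    intro b b' hb hb' j hlt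
    have hne : (({Sum.inl j} : Finset (Fin M ⊕ Fin M))ᶜ).Nonempty := ⟨Sum.inr j, by simp⟩
    have hupper := (hb _ (Finset.singleton_nonempty _) hne).2
    have hlower := (hb' _ (Finset.singleton_nonempty _) hne).1
    rw [cutVal_bipW_singleton_inl d _ j (hdle _)] at hupper hlower
    have hgap := mul_lt_of_ratio_lt hr d hdratio hlt
    rw [div_mul_eq_mul_div, div_lt_iff₀ hpos] at hgap
    linarith
  funext j
  exact le_antisymm (not_lt.1 (hnot h' h j)) (not_lt.1 (hnot h h' j))

/-- **lower bound, unweighted graphs.**  Fix `0 < ε < 1` and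
`r = (1+ε)/(1−ε)`.  Let `d_0 < d_1 < ⋯ < d_K ≤ n/2` be positive integers with
`d_{i+1} > r·d_i`, and let `F` be the family of bipartite unweighted graphs with `M = n/2`
vertices on each side, one for each assignment `a` of a degree `d (a j)` to each left
vertex `j` (realized by `bipW`), distinct assignments giving distinct members.  Then
(i) no weighted graph `H` can be an `ε`-sparsifier of two distinct members of `F`, and
(ii) any scheme encoding each `G ∈ F` into an `L`-bit string from which some `H` with
`H ∈ (1±ε)G` can be recovered must have `L ≥ log₂|F| = (n/2)·log₂(K+1)`, which is
`Ω(n(log log n + log(1/ε)))`. -/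
theorem unweighted_lower_bound (ε : ℝ) (hε0 : 0 < ε) (hε1 : ε < 1)
    (M : ℕ) (hM : 1 ≤ M) (K : ℕ) (d : Fin (K + 1) → ℕ)
    (hdpos : ∀ i, 0 < d i)
    (hdratio : ∀ i : Fin K, ((1 + ε) / (1 - ε)) * d i.castSucc < d i.succ)
    (hdle : ∀ i, d i ≤ M) :
    (∀ a a' : Fin M → Fin (K + 1),
      ∀ H : (Fin M ⊕ Fin M) → (Fin M ⊕ Fin M) → ℝ,
        (∀ u v, H u v = H v u) → (∀ u v, 0 ≤ H u v) →
        IsSparsifier ε H (bipW d a) → IsSparsifier ε H (bipW d a') → a = a') ∧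
    (∀ (L : ℕ) (enc : (Fin M → Fin (K + 1)) → Fin L → Bool)
        (dec : (Fin L → Bool) → (Fin M ⊕ Fin M) → (Fin M ⊕ Fin M) → ℝ),
      (∀ a, IsSparsifier ε (dec (enc a)) (bipW d a)) →
      (M : ℝ) * Real.logb 2 ((K : ℝ) + 1) ≤ L) := by
  refine ⟨fun a a' H _ _ h h' => eq_of_isSparsifier_bipW hε0 hε1 hdratio hdle h h', ?_⟩
  intro L enc dec hdec
  have hinj : Function.Injective enc := fun a a' haa' =>
    eq_of_isSparsifier_bipW hε0 hε1 hdratio hdle (hdec a) (haa' ▸ hdec a')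
  have hcard : (K + 1) ^ M ≤ 2 ^ L := by
    simpa using Fintype.card_le_of_injective enc hinj
  have hcard' : ((K : ℝ) + 1) ^ M ≤ 2 ^ L := by exact_mod_cast hcard
  have hlog := Real.logb_le_logb_of_le one_lt_two (by positivity) hcard'
  simpa [Real.logb_pow] using hlog
end
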